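/- Let A ⊆ B(H) be a finite-dimensional C*-algebra and A = {A_1,…,A_n} ⊆ A_h a finite sequence of Hermitian elements. Then the dual diamond norm of the qc-map Φ^qc_A satisfies ‖Φ^qc_A‖^◇ = ∑_{i=1}^n ‖A_i‖, where ‖A_i‖ is the operator norm. (The norm ‖·‖^◇ on L(A,𝔻_n) is independent of the choice of admissible family 𝒫.) -/

import Mathlib

noncomputable section

open Matrix Complex Filter
open scoped Kronecker ComplexOrder

/-- The algebra `B(H)` of operators on the Hilbert space with orthonormal basis indexed by `ι`,
modelled as matrices. -/
abbrev Mat (ι : Type) : Type := Matrix ι ι ℂ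

/-- The space of all maps `B(H) → B(K)`. -/
abbrev HMap (ι κ : Type) : Type := Mat ι → Mat κ

section Defs
variable {ι κ μ ν γ γ' : Type}

/-- A Hermitian (i.e. complex-linear and Hermiticity preserving) map `B(H) → B(K)`. -/
def IsHermMap [Fintype ι] [Fintype κ] (φ : HMap ι κ) : Prop :=
  IsLinearMap ℂ φ ∧ ∀ a : Mat ι, φ aᴴ = (φ a)ᴴ

/-- The real vector space `L(H,K)` of Hermitian maps, as a subset of all maps. -/
def LHK (ι κ : Type) [Fintype ι] [Fintype κ] : Set (HMap ι κ) := {φ | IsHermMap φ}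

/-- The functional `s(φ) = ∑_{i,j} ⟨e_i, φ(|e_i⟩⟨e_j|) e_j⟩`. -/
def sC [Fintype ι] [DecidableEq ι] (φ : HMap ι ι) : ℂ :=
  ∑ i, ∑ j, φ (Matrix.single i j 1) i j

/-- The duality pairing `⟨φ,ψ⟩ = s(ψ ∘ φ)` between `L(H,K)` and `L(K,H)`. -/
def pairing [Fintype ι] [DecidableEq ι] [Fintype κ] (φ : HMap ι κ) (ψ : HMap κ ι) : ℝ :=
  (sC (ψ ∘ φ)).re

/-- The map `φ ⊗ id_F`. -/
def tensorId (φ : HMap ι κ) (γ : Type) : Mat (ι × γ) → Mat (κ × γ) :=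
  fun M => Matrix.of fun p q => φ (Matrix.of fun i i' => M (i, p.2) (i', q.2)) p.1 q.1

/-- The map `id ⊗ f` on `B(H ⊗ D)`. -/
def idTensor (ι : Type) (f : HMap γ γ') : Mat (ι × γ) → Mat (ι × γ') :=
  fun M => Matrix.of fun p q => f (Matrix.of fun c c' => M (p.1, c) (q.1, c')) p.2 q.2

/-- The tensor product `φ ⊗ ξ` of two maps. -/
def tensorFun [Fintype ι] [DecidableEq ι] (φ : HMap ι κ) (ξ : HMap γ γ') :
    Mat (ι × γ) → Mat (κ × γ') :=
  fun M => Matrix.of fun p q =>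
    ∑ i, ∑ i', φ (Matrix.single i i' 1) p.1 q.1 *
      ξ (Matrix.of fun c c' => M (i, c) (i', c')) p.2 q.2

/-- The Choi matrix `C(φ) = (φ ⊗ id)(X_H)` of a map `φ : B(H) → B(K)`. -/
def Choi [DecidableEq ι] (φ : HMap ι κ) : Mat (κ × ι) :=
  Matrix.of fun p q => φ (Matrix.single p.2 q.2 1) p.1 q.1

/-- The adjoint of a map with respect to the Hilbert-Schmidt inner products. -/
def adjFun [Fintype ι] [Fintype κ] [DecidableEq ι] (φ : HMap ι κ) : HMap κ ι :=
  fun b => Matrix.of fun i j => (φ (Matrix.single j i 1) * b).trace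

/-- Trace preserving maps. -/
def TP [Fintype ι] [Fintype κ] (φ : HMap ι κ) : Prop := ∀ a, (φ a).trace = a.trace

/-- The cone `Pos(H,K)` of positive Hermitian maps. -/
def PosSet (ι κ : Type) [Fintype ι] [Fintype κ] : Set (HMap ι κ) :=
  {φ | IsHermMap φ ∧ ∀ a, a.PosSemidef → (φ a).PosSemidef}

/-- The cone `CP(H,K)` of completely positive Hermitian maps. -/
def CPSet (ι κ : Type) [Fintype ι] [Fintype κ] : Set (HMap ι κ) :=
  {φ | IsHermMap φ ∧ ∀ (n : ℕ) (M : Mat (ι × Fin n)),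
      M.PosSemidef → (tensorId φ (Fin n) M).PosSemidef}

/-- The cone `EB(H,K)` of entanglement breaking maps `a ↦ ∑_i Tr(F_i a) ρ_i`. -/
def EBSet (ι κ : Type) [Fintype ι] [Fintype κ] : Set (HMap ι κ) :=
  {φ | ∃ (N : ℕ) (F : Fin N → Mat ι) (ρ : Fin N → Mat κ),
      (∀ i, (F i).PosSemidef) ∧ (∀ i, (ρ i).PosSemidef) ∧
      φ = fun a => ∑ i, ((F i * a).trace) • ρ i}

/-- Interior of `Q` relative to the subset `L`. -/
def relInt {X : Type*} [TopologicalSpace X] (L Q : Set X) : Set X :=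
  {x | x ∈ Q ∧ Q ∈ nhdsWithin x L}

/-- A proper cone in the (sub)space `L`: closed, convex, closed under nonnegative scalar
multiples, pointed, and with nonempty interior relative to `L`. -/
def IsProperConeIn {X : Type*} [TopologicalSpace X] [AddCommGroup X] [Module ℝ X]
    (L Q : Set X) : Prop :=
  Q ⊆ L ∧ IsClosed Q ∧ Convex ℝ Q ∧ (∀ c : ℝ, 0 ≤ c → ∀ x ∈ Q, c • x ∈ Q) ∧
    (∀ x, x ∈ Q → -x ∈ Q → x = 0) ∧ (relInt L Q).Nonempty

end Defs

/-- An admissible family of positive cones: a proper cone `Pf(H,K) ⊆ L(H,K)` for every pair of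
(finite-dimensional) Hilbert spaces, with `EB ⊆ Pf ⊆ Pos`, closed under composition and under
composition with completely positive maps. -/
structure AdmissibleFamily : Type 1 where
  P : ∀ (ι κ : Type) [Fintype ι] [DecidableEq ι] [Fintype κ] [DecidableEq κ], Set (HMap ι κ)
  proper : ∀ (ι κ : Type) [Fintype ι] [DecidableEq ι] [Fintype κ] [DecidableEq κ],
    IsProperConeIn (LHK ι κ) (P ι κ)
  eb_le : ∀ (ι κ : Type) [Fintype ι] [DecidableEq ι] [Fintype κ] [DecidableEq κ],
    EBSet ι κ ⊆ P ι κ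
  le_pos : ∀ (ι κ : Type) [Fintype ι] [DecidableEq ι] [Fintype κ] [DecidableEq κ],
    P ι κ ⊆ PosSet ι κ
  comp_mem : ∀ (ι κ μ : Type) [Fintype ι] [DecidableEq ι] [Fintype κ] [DecidableEq κ]
      [Fintype μ] [DecidableEq μ],
    ∀ φ ∈ P ι κ, ∀ ψ ∈ P κ μ, (ψ ∘ φ) ∈ P ι μ
  cp_comp_mem : ∀ (ι κ μ ν : Type) [Fintype ι] [DecidableEq ι] [Fintype κ] [DecidableEq κ]
      [Fintype μ] [DecidableEq μ] [Fintype ν] [DecidableEq ν],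
    ∀ β ∈ CPSet ι κ, ∀ φ ∈ P κ μ, ∀ α ∈ CPSet μ ν, (α ∘ φ ∘ β) ∈ P ι ν

structure FdSubalgebra (ι : Type) [Fintype ι] [DecidableEq ι] : Type where
  car : Set (Mat ι)
  add_mem : ∀ {x y}, x ∈ car → y ∈ car → x + y ∈ car
  smul_mem : ∀ (c : ℂ) {x}, x ∈ car → c • x ∈ car
  one_mem : (1 : Mat ι) ∈ car
  mul_mem : ∀ {x y}, x ∈ car → y ∈ car → x * y ∈ car
  star_mem : ∀ {x}, x ∈ car → xᴴ ∈ car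
  E : Mat ι → Mat ι
  E_linear : IsLinearMap ℂ E
  E_mem : ∀ x, E x ∈ car
  E_fix : ∀ x ∈ car, E x = x
  E_trace : ∀ x y, y ∈ car → (E x * y).trace = (x * y).trace

namespace FdSubalgebra

set_option linter.unusedSectionVars false
variable {ι γ : Type} [Fintype ι] [DecidableEq ι] [Fintype γ] [DecidableEq γ]

lemma zero_mem (A : FdSubalgebra ι) : (0 : Mat ι) ∈ A.car := by
  simpa using A.smul_mem 0 A.one_mem

lemma sum_mem (A : FdSubalgebra ι) {α : Type*} {s : Finset α} {f : α → Mat ι}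
    (h : ∀ a ∈ s, f a ∈ A.car) : (∑ a ∈ s, f a) ∈ A.car :=
  Finset.sum_induction f (· ∈ A.car) (fun _ _ hx hy => A.add_mem hx hy) A.zero_mem h

/-- The full matrix algebra `B(H)`. -/
def full (ι : Type) [Fintype ι] [DecidableEq ι] : FdSubalgebra ι where
  car := Set.univ
  add_mem := fun _ _ => Set.mem_univ _
  smul_mem := by intro _ x _; exact Set.mem_univ _
  one_mem := Set.mem_univ _
  mul_mem := fun _ _ => Set.mem_univ _
  star_mem := fun _ => Set.mem_univ _
  E := id
  E_linear := ⟨fun _ _ => rfl, fun _ _ => rfl⟩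
  E_mem := fun _ => trivial
  E_fix := fun _ _ => rfl
  E_trace := fun _ _ _ => rfl

/-- The diagonal subalgebra `𝔻_n ⊆ B(ℂ^n)`. -/
def diag (n : ℕ) : FdSubalgebra (Fin n) where
  car := {M | ∀ i j, i ≠ j → M i j = 0}
  add_mem := by
    intro x y hx hy i j hij
    simp [hx i j hij, hy i j hij]
  smul_mem := by
    intro c x hx i j hij
    simp [hx i j hij]
  one_mem := by
    intro i j hij
    exact Matrix.one_apply_ne hij
  mul_mem := by
    intro x y hx hy i j hij
    show ∑ k, x i k * y k j = 0
    refine Finset.sum_eq_zero fun k _ => ?_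
    rcases eq_or_ne k i with rfl | hk
    · simp [hy k j hij]
    · simp [hx i k (Ne.symm hk)]
  star_mem := by
    intro x hx i j hij
    simp [Matrix.conjTranspose_apply, hx j i (Ne.symm hij)]
  E := fun M => Matrix.diagonal fun i => M i i
  E_linear := by
    constructor
    · intro x y
      ext i j
      by_cases h : i = j <;> simp [Matrix.diagonal, h]
    · intro c x
      ext i j
      by_cases h : i = j <;> simp [Matrix.diagonal, h]
  E_mem := by
    intro x i j hij
    simp [Matrix.diagonal_apply_ne _ hij]
  E_fix := by
    intro x hx
    ext i j
    by_cases h : i = j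
    · subst h; simp
    · simp [Matrix.diagonal_apply_ne _ h, hx i j h]
  E_trace := by
    intro x y hy
    have key : ∀ z : Mat (Fin n), (z * y).trace = ∑ i, z i i * y i i := by
      intro z
      simp only [Matrix.trace, Matrix.diag, Matrix.mul_apply]
      refine Finset.sum_congr rfl fun i _ => ?_
      refine Finset.sum_eq_single i (fun k _ hk => ?_) (by simp)
      simp [hy k i hk]
    rw [key, key]
    refine Finset.sum_congr rfl fun i _ => ?_
    simp


/-- The `(c,d)` block of a matrix on `H ⊗ D`. -/
def blk (M : Mat (ι × γ)) (c d : γ) : Mat ι := Matrix.of fun i j => M (i, c) (j, d)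

lemma blk_add (M N : Mat (ι × γ)) (c d : γ) : blk (M + N) c d = blk M c d + blk N c d := by
  ext i j; simp [blk]

lemma blk_smul (a : ℂ) (M : Mat (ι × γ)) (c d : γ) : blk (a • M) c d = a • blk M c d := by
  ext i j; simp [blk]

lemma blk_mul (M N : Mat (ι × γ)) (c d : γ) :
    blk (M * N) c d = ∑ e, blk M c e * blk N e d := by
  ext i j
  simp only [blk, Matrix.of_apply, Matrix.mul_apply, Matrix.sum_apply, Fintype.sum_prod_type]
  exact Finset.sum_comm

lemma trace_blk (M : Mat (ι × γ)) : M.trace = ∑ c, (blk M c c).trace := by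
  simp only [Matrix.trace, Matrix.diag, blk, Matrix.of_apply, Fintype.sum_prod_type]
  exact Finset.sum_comm

/-- The tensor product algebra `A ⊗ B(D) ⊆ B(H ⊗ D)`. -/
def tensorFull (A : FdSubalgebra ι) (γ : Type) [Fintype γ] [DecidableEq γ] :
    FdSubalgebra (ι × γ) where
  car := {M | ∀ c d, blk M c d ∈ A.car}
  add_mem := by
    intro x y hx hy c d
    rw [blk_add]; exact A.add_mem (hx c d) (hy c d)
  smul_mem := by
    intro a x hx c d
    rw [blk_smul]; exact A.smul_mem a (hx c d)
  one_mem := by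
    intro c d
    rcases eq_or_ne c d with rfl | hcd
    · have : blk (1 : Mat (ι × γ)) c c = 1 := by
        ext i j
        by_cases h : i = j
        · subst h; simp [blk, Matrix.one_apply]
        · simp [blk, Matrix.one_apply, h]
      rw [this]; exact A.one_mem
    · have : blk (1 : Mat (ι × γ)) c d = 0 := by
        ext i j
        simp [blk, Matrix.one_apply, hcd]
      rw [this]; exact A.zero_mem
  mul_mem := by
    intro x y hx hy c d
    rw [blk_mul]
    exact A.sum_mem fun e _ => A.mul_mem (hx c e) (hy e d)
  star_mem := by
    intro x hx c d
    have : blk xᴴ c d = (blk x d c)ᴴ := by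
      ext i j; simp [blk, Matrix.conjTranspose_apply]
    rw [this]; exact A.star_mem (hx d c)
  E := fun M => Matrix.of fun p q => A.E (blk M p.2 q.2) p.1 q.1
  E_linear := by
    constructor
    · intro x y
      ext p q
      simp [blk_add, (A.E_linear.map_add _ _)]
    · intro a x
      ext p q
      simp [blk_smul, (A.E_linear.map_smul _ _)]
  E_mem := by
    intro x c d
    have : blk (Matrix.of fun p q => A.E (blk x p.2 q.2) p.1 q.1) c d = A.E (blk x c d) := by
      ext i j; simp [blk]
    rw [this]; exact A.E_mem _
  E_fix := by
    intro x hx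
    ext p q
    show A.E (blk x p.2 q.2) p.1 q.1 = x p q
    rw [A.E_fix _ (hx p.2 q.2)]
    rfl
  E_trace := by
    intro x y hy
    have key : ∀ z : Mat (ι × γ), (z * y).trace = ∑ c, ∑ d, (blk z c d * blk y d c).trace := by
      intro z
      rw [trace_blk (z * y)]
      refine Finset.sum_congr rfl fun c _ => ?_
      rw [blk_mul, Matrix.trace_sum]
    rw [key, key]
    refine Finset.sum_congr rfl fun c _ => ?_
    refine Finset.sum_congr rfl fun d _ => ?_
    have hblk : blk (Matrix.of fun p q => A.E (blk x p.2 q.2) p.1 q.1) c d = A.E (blk x c d) := by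
      ext i j; simp [blk]
    rw [hblk, A.E_trace _ _ (hy d c)]

end FdSubalgebra


section Main
variable {ι κ μ ν γ γ' : Type}
variable [Fintype ι] [DecidableEq ι] [Fintype κ] [DecidableEq κ]

/-- The subspace `L(A,B)` of maps identified with `E_B ∘ φ ∘ E_A`. -/
def LAB (A : FdSubalgebra ι) (B : FdSubalgebra κ) : Set (HMap ι κ) :=
  {φ | (∀ a, φ a ∈ B.car) ∧ ∀ a, φ (A.E a) = φ a}

/-- The density operators (states) of the algebra `A`. -/
def States (A : FdSubalgebra ι) : Set (Mat ι) :=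
  {σ | σ ∈ A.car ∧ σ.PosSemidef ∧ σ.trace = 1}

/-- The map `Φ_{I,σ} : a ↦ (Tr a) σ`. -/
def PhiI (ι : Type) [Fintype ι] (σ : Mat κ) : HMap ι κ := fun a => a.trace • σ

/-- The cone `Pf(A,B) = Pf(H,K) ∩ L(A,B)`. -/
def PL (Pf : AdmissibleFamily) (A : FdSubalgebra ι) (B : FdSubalgebra κ) : Set (HMap ι κ) :=
  Pf.P ι κ ∩ LAB A B

/-- The set `𝒞(A,B)` of `Pf`-channels, i.e. trace preserving maps in `Pf(A,B)`. -/
def ChanP (Pf : AdmissibleFamily) (A : FdSubalgebra ι) (B : FdSubalgebra κ) : Set (HMap ι κ) :=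
  {φ | φ ∈ PL Pf A B ∧ TP φ}

/-- The dual cone `Pf*(A,B) = Pf*(H,K) ∩ L(A,B)`, where `Pf*(H,K) ⊆ L(H,K)` is the dual cone
of `Pf(K,H)` with respect to the pairing `⟨·,·⟩`. -/
def PstarL (Pf : AdmissibleFamily) (A : FdSubalgebra ι) (B : FdSubalgebra κ) :
    Set (HMap ι κ) :=
  {ψ | IsHermMap ψ ∧ ψ ∈ LAB A B ∧ ∀ χ ∈ Pf.P κ ι, 0 ≤ pairing ψ χ}

/-- The diamond norm `‖φ‖_◇ = inf{λ>0 : ∃ α ∈ 𝒞(A,B), λα ± φ ∈ Pf(A,B)}`. -/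
def dnormP (Pf : AdmissibleFamily) (A : FdSubalgebra ι) (B : FdSubalgebra κ)
    (φ : HMap ι κ) : ℝ :=
  sInf {l : ℝ | 0 < l ∧ ∃ α ∈ ChanP Pf A B,
    (l • α - φ) ∈ PL Pf A B ∧ (l • α + φ) ∈ PL Pf A B}

/-- The dual diamond norm `‖φ‖^◇ = inf{λ>0 : ∃ σ ∈ 𝔖(B), λ Φ_{I,σ} ± φ ∈ Pf*(A,B)}`. -/
def udnormP (Pf : AdmissibleFamily) (A : FdSubalgebra ι) (B : FdSubalgebra κ)
    (φ : HMap ι κ) : ℝ :=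
  sInf {l : ℝ | 0 < l ∧ ∃ σ ∈ States B,
    (l • PhiI ι σ - φ) ∈ PstarL Pf A B ∧ (l • PhiI ι σ + φ) ∈ PstarL Pf A B}

/-- `CP(A,B) = CP(H,K) ∩ L(A,B)`. -/
def CPL (A : FdSubalgebra ι) (B : FdSubalgebra κ) : Set (HMap ι κ) :=
  CPSet ι κ ∩ LAB A B

/-- Completely positive trace preserving channels `A → B`. -/
def ChanCP (A : FdSubalgebra ι) (B : FdSubalgebra κ) : Set (HMap ι κ) :=
  {φ | φ ∈ CPL A B ∧ TP φ}

/-- The dual diamond norm with respect to the family `CP` (recall `CP* = CP`). -/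
def udnormCP (A : FdSubalgebra ι) (B : FdSubalgebra κ) (φ : HMap ι κ) : ℝ :=
  sInf {l : ℝ | 0 < l ∧ ∃ σ ∈ States B,
    (l • PhiI ι σ - φ) ∈ CPL A B ∧ (l • PhiI ι σ + φ) ∈ CPL A B}

/-- The qc-map `Φ^qc_A : b ↦ ∑_i Tr(A_i b) |e_i⟩⟨e_i|` given by operators `A_1, …, A_n`. -/
def PhiQC {n : ℕ} (A : Fin n → Mat ι) : HMap ι (Fin n) :=
  fun b => Matrix.diagonal fun i => (A i * b).trace

/-- The cq-map `Φ^cq_A : x ↦ ∑_i ⟨e_i, x e_i⟩ A_i` given by operators `A_1, …, A_n`. -/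
def PhiCQ {n : ℕ} (A : Fin n → Mat ι) : HMap (Fin n) ι :=
  fun x => ∑ i, x i i • A i

open scoped MatrixOrder in
/-- The trace norm `‖A‖₁ = Tr √(AᴴA)`. -/
def traceNorm (A : Mat ι) : ℝ :=
  ((CFC.sqrt (Aᴴ * A)).trace).re

/-- The operator norm of a matrix. -/
def opNorm (A : Mat ι) : ℝ := ‖Matrix.toEuclideanCLM (𝕜 := ℂ) A‖

/-- The cone `C(~Pf(H,K)) ⊆ B_h(K ⊗ H)` of Choi matrices of adjoints of maps in the dual cone
`Pf*(K,H)`. -/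
def tildeCone (Pf : AdmissibleFamily) (ι κ : Type) [Fintype ι] [DecidableEq ι]
    [Fintype κ] [DecidableEq κ] : Set (Mat (κ × ι)) :=
  {X | ∃ ψ : HMap κ ι, IsHermMap ψ ∧ (∀ χ ∈ Pf.P ι κ, 0 ≤ pairing χ ψ) ∧
    X = Choi (adjFun ψ)}

/-- The base norm `‖X‖_{1,~Pf} = sup{Tr XY : -I ≤_{~Pf} Y ≤_{~Pf} I}` on `B_h(K ⊗ H)`. -/
def oneNormTilde (Pf : AdmissibleFamily) (X : Mat (κ × ι)) : ℝ :=
  sSup {r : ℝ | ∃ Y : Mat (κ × ι), (1 - Y) ∈ tildeCone Pf ι κ ∧ (1 + Y) ∈ tildeCone Pf ι κ ∧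
    r = ((X * Y).trace).re}

/-- The order unit norm `‖X‖_C = inf{λ>0 : -λ1 ≤_C X ≤_C λ1}` for a cone `C` of matrices. -/
def ordUnitNorm {α : Type} [Fintype α] [DecidableEq α] (C : Set (Mat α)) (X : Mat α) : ℝ :=
  sInf {l : ℝ | 0 < l ∧ (l • (1 : Mat α) - X) ∈ C ∧ (l • (1 : Mat α) + X) ∈ C}

open Classical in
open scoped MatrixOrder in
/-- `(σ + ε I)^{-1/2}`. -/
def invSqrtShift (σ : Mat κ) (ε : ℝ) : Mat κ :=
  if _h : (σ + (ε : ℂ) • 1).PosSemidef then (CFC.sqrt (σ + (ε : ℂ) • 1))⁻¹ else 0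

variable {κ' δ : Type} [Fintype κ'] [DecidableEq κ'] [Fintype δ] [DecidableEq δ]

/-- `Ψ` is `(ε,D)`-post-processing deficient with respect to `Φ` (relative to the family `Pf`):
for every payoff map `Γ ∈ Pf*(D,A)` and every `α ∈ 𝒞(B,D)` there is `α' ∈ 𝒞(B',D)` with
`⟨α∘Φ,Γ⟩ ≤ ⟨α'∘Ψ,Γ⟩ + ε‖Γ‖^◇`. -/
def PostDeficientP (Pf : AdmissibleFamily) (A : FdSubalgebra ι) (B : FdSubalgebra κ)
    (B' : FdSubalgebra κ') (D : FdSubalgebra δ) (Φ : HMap ι κ) (Ψ : HMap ι κ') (ε : ℝ) :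
    Prop :=
  ∀ Γ ∈ PstarL Pf D A, ∀ α ∈ ChanP Pf B D, ∃ α' ∈ ChanP Pf B' D,
    pairing (α ∘ Φ) Γ ≤ pairing (α' ∘ Ψ) Γ + ε * udnormP Pf D A Γ

/-- Post-processing deficiency for the admissible family `CP` (recall `CP* = CP`). -/
def PostDeficientCP (A : FdSubalgebra ι) (B : FdSubalgebra κ)
    (B' : FdSubalgebra κ') (D : FdSubalgebra δ) (Φ : HMap ι κ) (Ψ : HMap ι κ') (ε : ℝ) :
    Prop :=
  ∀ Γ ∈ CPL D A, ∀ α ∈ ChanCP B D, ∃ α' ∈ ChanCP B' D,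
    pairing (α ∘ Φ) Γ ≤ pairing (α' ∘ Ψ) Γ + ε * udnormCP D A Γ

variable {ι' : Type} [Fintype ι'] [DecidableEq ι']

/-- `Ψ` is `(ε,D)`-pre-processing deficient with respect to `Φ` (relative to `Pf`). -/
def PreDeficientP (Pf : AdmissibleFamily) (A : FdSubalgebra ι) (A' : FdSubalgebra ι')
    (B : FdSubalgebra κ) (D : FdSubalgebra δ) (Φ : HMap ι κ) (Ψ : HMap ι' κ) (ε : ℝ) :
    Prop :=
  ∀ Γ ∈ PstarL Pf B D, ∀ β ∈ ChanP Pf D A, ∃ β' ∈ ChanP Pf D A',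
    pairing (Φ ∘ β) Γ ≤ pairing (Ψ ∘ β') Γ + ε * udnormP Pf B D Γ

/-- Pre-processing deficiency for the admissible family `CP`. -/
def PreDeficientCP (A : FdSubalgebra ι) (A' : FdSubalgebra ι') (B : FdSubalgebra κ)
    (D : FdSubalgebra δ) (Φ : HMap ι κ) (Ψ : HMap ι' κ) (ε : ℝ) : Prop :=
  ∀ Γ ∈ CPL B D, ∀ β ∈ ChanCP D A, ∃ β' ∈ ChanCP D A',
    pairing (Φ ∘ β) Γ ≤ pairing (Ψ ∘ β') Γ + ε * udnormCP B D Γ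

/-- `Ψ ⊇_ε Φ`: `sup_{σ ∈ SA} inf_{ρ ∈ SA'} ‖f(σ) - g(ρ)‖₁ ≤ 2ε`. -/
def SupsetCond {α α' β : Type} [Fintype β] [DecidableEq β] (SA : Set (Mat α)) (SA' : Set (Mat α'))
    (f : Mat α → Mat β) (g : Mat α' → Mat β) (ε : ℝ) : Prop :=
  sSup {r : ℝ | ∃ σ ∈ SA, r = sInf {t : ℝ | ∃ ρ ∈ SA', t = traceNorm (f σ - g ρ)}} ≤ 2 * ε

end Main


section Helpers
variable {ι : Type} [Fintype ι] [DecidableEq ι]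

lemma hp_trace_mul_nonneg {M N : Mat ι} (hM : M.PosSemidef) (hN : N.PosSemidef) :
    0 ≤ ((M * N).trace).re := by
  obtain ⟨B, rfl⟩ : ∃ B : Mat ι, N = Bᴴ * B := by
    open scoped MatrixOrder in
    exact CStarAlgebra.nonneg_iff_eq_star_mul_self.mp (Matrix.nonneg_iff_posSemidef.mpr hN)
  have h : (B * M * Bᴴ).PosSemidef := hM.mul_mul_conjTranspose_same B
  have h2 := h.trace_nonneg
  rw [← Matrix.mul_assoc, Matrix.trace_mul_comm, ← Matrix.mul_assoc]
  exact (Complex.nonneg_iff.mp h2).1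

lemma hp_psd_iff {M : Mat ι} (hM : M.IsHermitian) :
    M.PosSemidef ↔ ∀ v : ι → ℂ, 0 ≤ (star v ⬝ᵥ (M *ᵥ v)).re := by
  rw [Matrix.posSemidef_iff_dotProduct_mulVec]
  constructor
  · intro h v
    exact (Complex.nonneg_iff.mp (h.2 v)).1
  · intro h
    refine ⟨hM, fun v => Complex.nonneg_iff.mpr ⟨h v, ?_⟩⟩
    have := hM.im_star_dotProduct_mulVec_self v
    exact this.symm

lemma hp_form (A : Mat ι) (v : ι → ℂ) :
    (Matrix.toEuclideanCLM (𝕜 := ℂ) A).reApplyInnerSelf (WithLp.toLp 2 v)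
      = (star v ⬝ᵥ (A *ᵥ v)).re := by
  rw [ContinuousLinearMap.reApplyInnerSelf_apply, inner_re_symm, Matrix.toEuclideanCLM_toLp,
    EuclideanSpace.inner_toLp_toLp, dotProduct_comm]
  rfl

lemma hp_norm (v : ι → ℂ) :
    ‖(WithLp.toLp 2 v : EuclideanSpace ℂ ι)‖ ^ 2 = (star v ⬝ᵥ v).re := by
  rw [← inner_self_eq_norm_sq (𝕜 := ℂ), EuclideanSpace.inner_toLp_toLp, dotProduct_comm]
  rfl

lemma hp_shift_herm {A : Mat ι} (hA : A.IsHermitian) (c : ℝ) :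
    ((c : ℂ) • (1 : Mat ι) - A).IsHermitian := by
  refine Matrix.IsHermitian.sub ?_ hA
  ext i j
  simp [Matrix.conjTranspose_apply, Matrix.one_apply, eq_comm]
  split_ifs <;> simp

lemma hp_psd_of_le {A : Mat ι} (hA : A.IsHermitian) {c : ℝ} (h : opNorm A ≤ c) :
    ((c : ℂ) • (1 : Mat ι) - A).PosSemidef := by
  rw [hp_psd_iff (hp_shift_herm hA c)]
  intro v
  have h1 := (Matrix.toEuclideanCLM (𝕜 := ℂ) A).rayleighQuotient_le_norm (WithLp.toLp 2 v)
  have h2 := le_trans (le_abs_self _) (h1.trans h)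
  rw [ContinuousLinearMap.rayleighQuotient, hp_form, hp_norm] at h2
  have h3 : (star v ⬝ᵥ (((c : ℂ) • (1 : Mat ι) - A) *ᵥ v)).re
      = c * (star v ⬝ᵥ v).re - (star v ⬝ᵥ (A *ᵥ v)).re := by
    simp [Matrix.sub_mulVec, Matrix.smul_mulVec, dotProduct_sub, dotProduct_smul]
  rw [h3]
  by_cases hv : v = 0
  · simp [hv]
  · have hpos : 0 < (star v ⬝ᵥ v).re := by
      rw [← hp_norm]
      have : (WithLp.toLp 2 v : EuclideanSpace ℂ ι) ≠ 0 := by simpa using hv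
      positivity
    rw [div_le_iff₀ hpos] at h2
    linarith

lemma hp_le_of_psd {A : Mat ι} (hA : A.IsHermitian) {c : ℝ} (hc : 0 ≤ c)
    (h1 : ((c : ℂ) • (1 : Mat ι) - A).PosSemidef)
    (h2 : ((c : ℂ) • (1 : Mat ι) - (-A)).PosSemidef) : opNorm A ≤ c := by
  have hsym : (Matrix.toEuclideanCLM (𝕜 := ℂ) A).IsSymmetric := by
    have := (Matrix.isSymmetric_toEuclideanLin_iff (A := A)).mpr hA
    exact this
  rw [opNorm, ContinuousLinearMap.norm_eq_iSup_rayleighQuotient _ hsym]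
  refine ciSup_le fun x => ?_
  obtain ⟨v, rfl⟩ : ∃ v : ι → ℂ, x = WithLp.toLp 2 v := ⟨x.ofLp, rfl⟩
  rw [ContinuousLinearMap.rayleighQuotient, hp_form, hp_norm]
  by_cases hv : v = 0
  · simpa [hv] using hc
  have hpos : 0 < (star v ⬝ᵥ v).re := by
    rw [← hp_norm]
    have : (WithLp.toLp 2 v : EuclideanSpace ℂ ι) ≠ 0 := by simpa using hv
    positivity
  rw [abs_div, abs_of_pos hpos, div_le_iff₀ hpos]
  have e1 := (hp_psd_iff h1.isHermitian).mp h1 v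
  have e2 := (hp_psd_iff h2.isHermitian).mp h2 v
  simp [Matrix.sub_mulVec, Matrix.add_mulVec, Matrix.neg_mulVec, Matrix.smul_mulVec,
    dotProduct_sub, dotProduct_add, dotProduct_smul] at e1 e2
  rw [abs_le]
  constructor <;> linarith

lemma hp_pairing {n : ℕ} (M : Fin n → Mat ι) (χ : HMap (Fin n) ι) (hχ : IsLinearMap ℂ χ) :
    pairing (PhiQC M) χ = ∑ i, ((M i * χ (Matrix.single i i 1)).trace).re := by
  unfold pairing sC
  rw [← Complex.re_sum]
  congr 1
  have h : ∀ j k, (χ ∘ PhiQC M) (Matrix.single j k 1)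
      = ∑ i, M i k j • χ (Matrix.single i i 1) := by
    intro j k
    have : PhiQC M (Matrix.single j k 1)
        = ∑ i, M i k j • (Matrix.single i i 1 : Mat (Fin n)) := by
      unfold PhiQC
      ext a b
      simp only [Matrix.sum_apply, Matrix.diagonal_apply, Matrix.smul_apply, Matrix.single_apply,
        Matrix.trace_mul_single]
      by_cases hab : a = b
      · subst hab
        simp
      · rw [if_neg hab]
        symm
        refine Finset.sum_eq_zero fun i _ => ?_
        rw [if_neg (fun h => hab (h.1.symm.trans h.2)), smul_zero]
    rw [Function.comp_apply, this]
    have := map_sum hχ.mk' (fun i => M i k j • (Matrix.single i i 1 : Mat (Fin n))) Finset.univ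
    simp only [IsLinearMap.mk'_apply] at this
    rw [this]
    exact Finset.sum_congr rfl fun i _ => hχ.map_smul _ _
  simp only [h, Matrix.sum_apply, Matrix.smul_apply, smul_eq_mul]
  simp only [Matrix.trace, Matrix.diag, Matrix.mul_apply]
  rw [Finset.sum_comm]
  rw [Finset.sum_congr rfl (fun k _ => Finset.sum_comm)]
  rw [Finset.sum_comm]

lemma hp_qc_mem (Pf : AdmissibleFamily) (A : FdSubalgebra ι) {n : ℕ} (M : Fin n → Mat ι)
    (hmem : ∀ i, M i ∈ A.car) (hM : ∀ i, (M i).PosSemidef) :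
    PhiQC M ∈ PstarL Pf A (FdSubalgebra.diag n) := by
  refine ⟨⟨⟨?_, ?_⟩, ?_⟩, ⟨?_, ?_⟩, ?_⟩
  · intro x y
    ext a b
    by_cases h : a = b <;> simp [PhiQC, Matrix.diagonal_apply, h, Matrix.mul_add]
  · intro c x
    ext a b
    by_cases h : a = b <;> simp [PhiQC, Matrix.diagonal_apply, h]
  · intro a
    unfold PhiQC
    rw [Matrix.diagonal_conjTranspose]
    congr 1
    funext i
    rw [Pi.star_apply, ← Matrix.trace_conjTranspose, Matrix.conjTranspose_mul, (hM i).1,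
      Matrix.trace_mul_comm]
  · intro a i j hij
    exact Matrix.diagonal_apply_ne _ hij
  · intro a
    unfold PhiQC
    congr 1
    funext i
    rw [Matrix.trace_mul_comm, A.E_trace _ _ (hmem i), Matrix.trace_mul_comm]
  · intro χ hχ
    have hpos := Pf.le_pos _ _ hχ
    rw [hp_pairing M χ hpos.1.1]
    refine Finset.sum_nonneg fun i _ => hp_trace_mul_nonneg (hM i) (hpos.2 _ ?_)
    have : (Matrix.single i i 1 : Mat (Fin n)) = Matrix.diagonal (Pi.single i 1) := by
      ext a b
      simp only [Matrix.single_apply, Matrix.diagonal_apply, Pi.single_apply]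
      grind
    rw [this]
    refine Matrix.PosSemidef.diagonal fun j => ?_
    by_cases h : j = i
    · subst h; simp
    · simp [h]

lemma hp_qc_psd (Pf : AdmissibleFamily) (A : FdSubalgebra ι) {n : ℕ} (M : Fin n → Mat ι)
    (hM : ∀ i, (M i).IsHermitian) (h : PhiQC M ∈ PstarL Pf A (FdSubalgebra.diag n)) (i : Fin n) :
    (M i).PosSemidef := by
  rw [hp_psd_iff (hM i)]
  intro v
  have hdiag : (Matrix.single i i 1 : Mat (Fin n)).PosSemidef := by
    have : (Matrix.single i i 1 : Mat (Fin n)) = Matrix.diagonal (Pi.single i 1) := by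
      ext a b
      simp only [Matrix.single_apply, Matrix.diagonal_apply, Pi.single_apply]
      grind
    rw [this]
    refine Matrix.PosSemidef.diagonal fun j => ?_
    by_cases h : j = i
    · subst h; simp
    · simp [h]
  have hχ : (fun x : Mat (Fin n) => ∑ _k : Fin 1,
      ((Matrix.single i i 1 * x).trace) • Matrix.vecMulVec v (star v)) ∈ EBSet (Fin n) ι :=
    ⟨1, fun _ => Matrix.single i i 1, fun _ => Matrix.vecMulVec v (star v),
      fun _ => hdiag, fun _ => Matrix.posSemidef_vecMulVec_self_star v, rfl⟩
  have hP := Pf.eb_le _ _ hχ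
  have h0 := h.2.2 _ hP
  rw [hp_pairing M _ (Pf.le_pos _ _ hP).1.1, Finset.sum_eq_single i] at h0
  · simpa [Matrix.mul_vecMulVec, Matrix.trace_vecMulVec, dotProduct_comm] using h0
  · intro j _ hj
    simp [hj, hj.symm]
  · simp

lemma hp_qc_eq {n : ℕ} (Av : Fin n → Mat ι) (l : ℝ) {σ : Mat (Fin n)}
    (hσ : σ ∈ (FdSubalgebra.diag n).car) (hr : ∀ i, (((σ i i).re : ℝ) : ℂ) = σ i i) :
    l • PhiI ι σ - PhiQC Av
      = PhiQC (fun i => (((l * (σ i i).re : ℝ) : ℂ)) • (1 : Mat ι) - Av i) := by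
  funext b
  ext i j
  by_cases hij : i = j
  · subst hij
    simp [PhiI, PhiQC, Matrix.sub_mul, hr]
    ring
  · simp [PhiI, PhiQC, hij, hσ i j hij]

lemma hp_qc_neg {n : ℕ} (Av : Fin n → Mat ι) : PhiQC (fun i => - Av i) = - PhiQC Av := by
  funext b
  ext i j
  by_cases hij : i = j <;> simp [PhiQC, Matrix.diagonal_apply, hij]

lemma hp_opNorm_neg (A : Mat ι) : opNorm (-A) = opNorm A := by
  simp [opNorm]

lemma hp_opNorm_nonneg (A : Mat ι) : 0 ≤ opNorm A := norm_nonneg _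

lemma hp_shift_mem (A : FdSubalgebra ι) {x : Mat ι} (hx : x ∈ A.car) (c : ℂ) :
    c • (1 : Mat ι) - x ∈ A.car := by
  have := A.add_mem (A.smul_mem c A.one_mem) (A.smul_mem (-1) hx)
  simpa [sub_eq_add_neg] using this

lemma hp_lower (Pf : AdmissibleFamily) (A : FdSubalgebra ι) {n : ℕ} (Av : Fin n → Mat ι)
    (hherm : ∀ i, (Av i).IsHermitian) {l : ℝ} (hl : 0 < l) {σ : Mat (Fin n)}
    (hσ : σ ∈ States (FdSubalgebra.diag n))
    (h1 : (l • PhiI ι σ - PhiQC Av) ∈ PstarL Pf A (FdSubalgebra.diag n))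
    (h2 : (l • PhiI ι σ + PhiQC Av) ∈ PstarL Pf A (FdSubalgebra.diag n)) :
    ∑ i, opNorm (Av i) ≤ l := by
  obtain ⟨hd, hpsd, htr⟩ := hσ
  have hnn : ∀ i, 0 ≤ σ i i := fun i => hpsd.diag_nonneg
  have hr : ∀ i, (((σ i i).re : ℝ) : ℂ) = σ i i := fun i =>
    Complex.ext (by simp) (by simpa using (Complex.nonneg_iff.mp (hnn i)).2)
  have h2' : (l • PhiI ι σ - PhiQC (fun i => - Av i)) ∈ PstarL Pf A (FdSubalgebra.diag n) := by
    rw [hp_qc_neg, sub_neg_eq_add]; exact h2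
  rw [hp_qc_eq _ l hd hr] at h1 h2'
  have key : ∀ i, opNorm (Av i) ≤ l * (σ i i).re := fun i =>
    hp_le_of_psd (hherm i) (mul_nonneg hl.le (Complex.nonneg_iff.mp (hnn i)).1)
      (hp_qc_psd Pf A _ (fun i => hp_shift_herm (hherm i) _) h1 i)
      (hp_qc_psd Pf A _ (fun i => hp_shift_herm (hherm i).neg _) h2' i)
  calc ∑ i, opNorm (Av i) ≤ ∑ i, l * (σ i i).re := Finset.sum_le_sum fun i _ => key i
    _ = l := by
      have := congrArg Complex.re htr
      simp [Matrix.trace] at this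
      rw [← Finset.mul_sum, this, mul_one]

lemma hp_upper (Pf : AdmissibleFamily) (A : FdSubalgebra ι) {n : ℕ} (hn : 0 < n)
    (Av : Fin n → Mat ι) (hmem : ∀ i, Av i ∈ A.car)
    (hherm : ∀ i, (Av i).IsHermitian) {l : ℝ} (hl : ∑ i, opNorm (Av i) < l) :
    0 < l ∧ ∃ σ ∈ States (FdSubalgebra.diag n),
      (l • PhiI ι σ - PhiQC Av) ∈ PstarL Pf A (FdSubalgebra.diag n) ∧
      (l • PhiI ι σ + PhiQC Av) ∈ PstarL Pf A (FdSubalgebra.diag n) := by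
  have hS : 0 ≤ ∑ i, opNorm (Av i) := Finset.sum_nonneg fun i _ => hp_opNorm_nonneg _
  have hl0 : 0 < l := hS.trans_lt hl
  set S := ∑ i, opNorm (Av i) with hSdef
  have hn' : (0 : ℝ) < n := by exact_mod_cast hn
  let s : Fin n → ℝ := fun i => (opNorm (Av i) + (l - S) / n) / l
  have hs : ∀ i, opNorm (Av i) ≤ l * s i := by
    intro i
    have : l * s i = opNorm (Av i) + (l - S) / n := by
      simp only [s]; field_simp
    rw [this]
    have : 0 ≤ (l - S) / n := div_nonneg (by linarith) hn'.le
    linarith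
  have hs0 : ∀ i, 0 ≤ s i := fun i =>
    div_nonneg (add_nonneg (hp_opNorm_nonneg _) (div_nonneg (by linarith) hn'.le)) hl0.le
  have hsum : ∑ i, s i = 1 := by
    simp only [s]
    rw [← Finset.sum_div, Finset.sum_add_distrib, ← hSdef]
    simp
    field_simp
    ring
  have hd : Matrix.diagonal (fun i => (s i : ℂ)) ∈ (FdSubalgebra.diag n).car :=
    fun i j hij => Matrix.diagonal_apply_ne _ hij
  have hr : ∀ i, (((Matrix.diagonal (fun i => (s i : ℂ)) i i).re : ℝ) : ℂ)
      = Matrix.diagonal (fun i => (s i : ℂ)) i i := by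
    intro i; simp
  refine ⟨hl0, Matrix.diagonal (fun i => (s i : ℂ)), ⟨hd, ?_, ?_⟩, ?_, ?_⟩
  · refine Matrix.PosSemidef.diagonal fun i => ?_
    simpa using hs0 i
  · rw [Matrix.trace_diagonal]
    exact_mod_cast hsum
  · rw [hp_qc_eq _ l hd hr]
    refine hp_qc_mem Pf A _ (fun i => hp_shift_mem A (hmem i) _) fun i => hp_psd_of_le (hherm i) ?_
    simpa using hs i
  · rw [← sub_neg_eq_add, ← hp_qc_neg, hp_qc_eq _ l hd hr]
    refine hp_qc_mem Pf A _ (fun i => hp_shift_mem A ?_ _) fun i =>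
      hp_psd_of_le (hherm i).neg ?_
    · simpa using A.smul_mem (-1) (hmem i)
    · rw [hp_opNorm_neg]; simpa using hs i

end Helpers

/-- `‖Φ^qc_A‖^◇ = ∑_i ‖A_i‖` for `A = {A_1,…,A_n} ⊆ A_h`.
(The statement holds for an arbitrary admissible family `𝒫`, hence the norm does not depend
on the choice of `𝒫`.) -/
theorem statement5 (Pf : AdmissibleFamily) {ι : Type} [Fintype ι] [DecidableEq ι]
    (A : FdSubalgebra ι) {n : ℕ} (Av : Fin n → Mat ι)
    (hmem : ∀ i, Av i ∈ A.car) (hherm : ∀ i, (Av i).IsHermitian) :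
    udnormP Pf A (FdSubalgebra.diag n) (PhiQC Av) = ∑ i, opNorm (Av i) := by
  unfold udnormP
  rcases Nat.eq_zero_or_pos n with rfl | hn
  · have : {l : ℝ | 0 < l ∧ ∃ σ ∈ States (FdSubalgebra.diag 0),
        (l • PhiI ι σ - PhiQC Av) ∈ PstarL Pf A (FdSubalgebra.diag 0) ∧
        (l • PhiI ι σ + PhiQC Av) ∈ PstarL Pf A (FdSubalgebra.diag 0)} = ∅ := by
      ext l
      simp only [Set.mem_ofPred_eq, Set.mem_empty_iff_false, iff_false]
      rintro ⟨_, σ, hσ, _⟩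
      have := hσ.2.2
      simp [Matrix.trace] at this
    rw [this]
    simp
  · refine le_antisymm ?_ ?_
    · refine le_of_forall_gt_imp_ge_of_dense fun l hl => ?_
      exact csInf_le ⟨0, fun x hx => hx.1.le⟩ (hp_upper Pf A hn Av hmem hherm hl)
    · refine le_csInf ⟨_, hp_upper Pf A hn Av hmem hherm (lt_add_one _)⟩ ?_
      rintro l ⟨hl, σ, hσ, h1, h2⟩
      exact hp_lower Pf A Av hherm hl hσ h1 h2
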